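/- For every (x,t) in the real plane, the matrix F(x,t) = e^{2Aᵀx − 8(Aᵀ)³t} + Q e^{−2Ax + 8A³t} N is invertible. -/

import Mathlib

open Matrix MeasureTheory Filter

noncomputable def mexp {p : ℕ} (M : Matrix (Fin p) (Fin p) ℝ) : Matrix (Fin p) (Fin p) ℝ :=
  ∑' k : ℕ, (k.factorial : ℝ)⁻¹ • M ^ k

def EigPos {p : ℕ} (A : Matrix (Fin p) (Fin p) ℝ) : Prop :=
  ∀ μ ∈ spectrum ℂ (A.map Complex.ofReal), 0 < μ.re

def Observable {p : ℕ} (A : Matrix (Fin p) (Fin p) ℝ) (C : Matrix (Fin 1) (Fin p) ℝ) : Prop :=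
  ∀ v : Fin p → ℝ, (∀ r : ℕ, (C * A ^ r) *ᵥ v = 0) → v = 0

def Controllable {p : ℕ} (A : Matrix (Fin p) (Fin p) ℝ) (B : Matrix (Fin p) (Fin 1) ℝ) : Prop :=
  ∀ v : Fin p → ℝ, (∀ r : ℕ, (Bᵀ * Aᵀ ^ r) *ᵥ v = 0) → v = 0

noncomputable def Qmat {p : ℕ} (A : Matrix (Fin p) (Fin p) ℝ) (C : Matrix (Fin 1) (Fin p) ℝ) :
    Matrix (Fin p) (Fin p) ℝ :=
  Matrix.of fun i j =>
    ∫ s in Set.Ioi (0 : ℝ), (mexp (-(s • Aᵀ)) * (Cᵀ * C) * mexp (-(s • A))) i j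

noncomputable def Nmat {p : ℕ} (A : Matrix (Fin p) (Fin p) ℝ) (B : Matrix (Fin p) (Fin 1) ℝ) :
    Matrix (Fin p) (Fin p) ℝ :=
  Matrix.of fun i j =>
    ∫ s in Set.Ioi (0 : ℝ), (mexp (-(s • A)) * (B * Bᵀ) * mexp (-(s • Aᵀ))) i j

noncomputable def Pmat {p : ℕ} (A : Matrix (Fin p) (Fin p) ℝ) (B : Matrix (Fin p) (Fin 1) ℝ)
    (C : Matrix (Fin 1) (Fin p) ℝ) : Matrix (Fin p) (Fin p) ℝ :=
  Matrix.of fun i j =>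
    ∫ s in Set.Ioi (0 : ℝ), (mexp (-(s • A)) * (B * C) * mexp (-(s • A))) i j

noncomputable def Fmat {p : ℕ} (A : Matrix (Fin p) (Fin p) ℝ) (B : Matrix (Fin p) (Fin 1) ℝ)
    (C : Matrix (Fin 1) (Fin p) ℝ) (x t : ℝ) : Matrix (Fin p) (Fin p) ℝ :=
  mexp ((2 * x) • Aᵀ - (8 * t) • Aᵀ ^ 3) +
    Qmat A C * mexp (-((2 * x) • A) + (8 * t) • A ^ 3) * Nmat A B

noncomputable def Emat {p : ℕ} (A : Matrix (Fin p) (Fin p) ℝ) (B : Matrix (Fin p) (Fin 1) ℝ)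
    (C : Matrix (Fin 1) (Fin p) ℝ) (x t : ℝ) : Matrix (Fin p) (Fin p) ℝ :=
  mexp ((2 * x) • A - (8 * t) • A ^ 3) +
    Pmat A B C * mexp (-((2 * x) • A) + (8 * t) • A ^ 3) * Pmat A B C

noncomputable def uFun {p : ℕ} (A : Matrix (Fin p) (Fin p) ℝ) (B : Matrix (Fin p) (Fin 1) ℝ)
    (C : Matrix (Fin 1) (Fin p) ℝ) (x t : ℝ) : ℝ :=
  -2 * ((Bᵀ * (Fmat A B C x t)⁻¹ * Cᵀ : Matrix (Fin 1) (Fin 1) ℝ) 0 0)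

noncomputable def vFun {p : ℕ} (A : Matrix (Fin p) (Fin p) ℝ) (B : Matrix (Fin p) (Fin 1) ℝ)
    (C : Matrix (Fin 1) (Fin p) ℝ) (x t : ℝ) : ℝ :=
  -2 * ((C * (Emat A B C x t)⁻¹ * B : Matrix (Fin 1) (Fin 1) ℝ) 0 0)

noncomputable def calQ {p : ℕ} (A : Matrix (Fin p) (Fin p) ℝ) (C : Matrix (Fin 1) (Fin p) ℝ)
    (x t : ℝ) : Matrix (Fin p) (Fin p) ℝ :=
  mexp (-(x • Aᵀ)) * mexp ((8 * t) • Aᵀ ^ 3) * Qmat A C * mexp (-(x • A)) * mexp ((8 * t) • A ^ 3)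

noncomputable def calN {p : ℕ} (A : Matrix (Fin p) (Fin p) ℝ) (B : Matrix (Fin p) (Fin 1) ℝ)
    (x : ℝ) : Matrix (Fin p) (Fin p) ℝ :=
  mexp (-(x • A)) * Nmat A B * mexp (-(x • Aᵀ))

noncomputable def Gam {p : ℕ} (A : Matrix (Fin p) (Fin p) ℝ) (B : Matrix (Fin p) (Fin 1) ℝ)
    (C : Matrix (Fin 1) (Fin p) ℝ) (x t : ℝ) : Matrix (Fin p) (Fin p) ℝ :=
  1 + calQ A C x t * calN A B x

noncomputable def Om {p : ℕ} (A : Matrix (Fin p) (Fin p) ℝ) (B : Matrix (Fin p) (Fin 1) ℝ)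
    (C : Matrix (Fin 1) (Fin p) ℝ) (w t : ℝ) : ℝ :=
  ((C * mexp (-(w • A)) * mexp ((8 * t) • A ^ 3) * B : Matrix (Fin 1) (Fin 1) ℝ) 0 0)

noncomputable def Kker {p : ℕ} (A : Matrix (Fin p) (Fin p) ℝ) (B : Matrix (Fin p) (Fin 1) ℝ)
    (C : Matrix (Fin 1) (Fin p) ℝ) (x y t : ℝ) : ℝ :=
  ((Bᵀ * (Fmat A B C x t)⁻¹ * mexp (-((y - x) • Aᵀ)) * Cᵀ : Matrix (Fin 1) (Fin 1) ℝ) 0 0)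

section helpers
open NormedSpace

lemma mexp_eq {p : ℕ} (M : Matrix (Fin p) (Fin p) ℝ) : mexp M = NormedSpace.exp M := by
  unfold mexp
  rw [NormedSpace.exp_eq_tsum ℝ]

open scoped Matrix.Norms.Operator in
lemma cont_mexp {p : ℕ} : Continuous (NormedSpace.exp : Matrix (Fin p) (Fin p) ℝ → _) :=
  NormedSpace.exp_continuous

open scoped Matrix.Norms.Operator in
lemma summ_exp {p : ℕ} (M : Matrix (Fin p) (Fin p) ℂ) :
    Summable fun n : ℕ => ((n.factorial : ℂ)⁻¹) • M ^ n :=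
  NormedSpace.expSeries_summable' M

open scoped Matrix.Norms.Operator in
lemma map_mexp {p : ℕ} (M : Matrix (Fin p) (Fin p) ℝ) :
    (NormedSpace.exp M).map Complex.ofReal = NormedSpace.exp (M.map Complex.ofReal) := by
  have := NormedSpace.map_exp (Complex.ofRealHom.mapMatrix (m := Fin p))
    (by
      show Continuous fun M : Matrix (Fin p) (Fin p) ℝ => M.map Complex.ofReal
      exact continuous_id.matrix_map Complex.continuous_ofReal) M
  exact this

def Dec (f : ℝ → ℂ) : Prop := ∃ b : ℝ, 0 < b ∧ f =O[atTop] fun s => Real.exp (-b * s)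

lemma exp_mono_bigO {b b' : ℝ} (h : b' ≤ b) :
    (fun s : ℝ => Real.exp (-b * s)) =O[atTop] fun s => Real.exp (-b' * s) := by
  apply Asymptotics.IsBigO.of_bound 1
  filter_upwards [eventually_ge_atTop 0] with s hs
  simp only [Real.norm_eq_abs, Real.abs_exp, one_mul, Real.exp_le_exp]
  nlinarith

lemma Dec.add {f g : ℝ → ℂ} (hf : Dec f) (hg : Dec g) : Dec (fun s => f s + g s) := by
  obtain ⟨b, hb, hf⟩ := hf
  obtain ⟨c, hc, hg⟩ := hg
  refine ⟨min b c, lt_min hb hc, ?_⟩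
  exact (hf.trans (exp_mono_bigO (min_le_left _ _))).add (hg.trans (exp_mono_bigO (min_le_right _ _)))

lemma Dec.zero : Dec (fun _ => 0) := ⟨1, one_pos, Asymptotics.isBigO_zero _ _⟩

lemma Dec.sum {ι : Type*} (s : Finset ι) {f : ι → ℝ → ℂ} (h : ∀ i ∈ s, Dec (f i)) :
    Dec (fun x => ∑ i ∈ s, f i x) := by
  classical
  induction s using Finset.induction_on with
  | empty => simpa using Dec.zero
  | insert a s ha ih =>
    simp only [Finset.sum_insert ha]
    exact (h a (by simp)).add (ih fun i hi => h i (by simp [hi]))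

lemma Dec.mul {f g : ℝ → ℂ} (hf : Dec f) (hg : Dec g) : Dec (fun s => f s * g s) := by
  obtain ⟨b, hb, hf⟩ := hf
  obtain ⟨c, hc, hg⟩ := hg
  refine ⟨b + c, add_pos hb hc, (hf.mul hg).congr_right fun s => ?_⟩
  rw [← Real.exp_add]; congr 1; ring

lemma Dec.const_mul {f : ℝ → ℂ} (hf : Dec f) (c : ℂ) : Dec (fun s => c * f s) := by
  obtain ⟨b, hb, hf⟩ := hf
  exact ⟨b, hb, hf.const_mul_left c⟩

lemma dec_basic (μ : ℂ) (hμ : 0 < μ.re) (k : ℕ) :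
    Dec fun s : ℝ => Complex.exp (-(s * μ)) * (s : ℂ) ^ k := by
  refine ⟨μ.re / 2, by positivity, ?_⟩
  have h1 : (fun s : ℝ => Complex.exp (-(s * μ))) =O[atTop] fun s => Real.exp (-μ.re * s) := by
    apply Asymptotics.IsBigO.of_bound 1
    refine Eventually.of_forall fun s => ?_
    rw [Complex.norm_exp]
    simp [mul_comm]
  have h2 : (fun s : ℝ => (s : ℂ) ^ k) =O[atTop] fun s => Real.exp (μ.re / 2 * s) := by
    refine Asymptotics.IsBigO.trans ?_ (isLittleO_pow_exp_pos_mul_atTop k (half_pos hμ)).isBigO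
    apply Asymptotics.IsBigO.of_bound 1
    exact Eventually.of_forall fun s => by simp
  refine (h1.mul h2).congr_right fun s => ?_
  rw [← Real.exp_add]; congr 1; ring

lemma exp_genEig {p : ℕ} (A : Matrix (Fin p) (Fin p) ℂ) (μ : ℂ) (v : Fin p → ℂ) (k : ℕ)
    (hv : (A - μ • 1) ^ k *ᵥ v = 0) (s : ℝ) :
    NormedSpace.exp (-((s : ℂ) • A)) *ᵥ v = ∑ n ∈ Finset.range k,
      (Complex.exp (-(s * μ)) * (s : ℂ) ^ n) •
        (((n.factorial : ℂ)⁻¹ * (-1) ^ n) • ((A - μ • 1) ^ n *ᵥ v)) := by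
  have e1 : -((s : ℂ) • A) = (-(s * μ)) • (1 : Matrix (Fin p) (Fin p) ℂ) + (-(s : ℂ)) • (A - μ • 1) := by
    module
  have e2 : NormedSpace.exp ((-(s * μ)) • (1 : Matrix (Fin p) (Fin p) ℂ)) =
      Complex.exp (-(s * μ)) • (1 : Matrix (Fin p) (Fin p) ℂ) := by
    rw [Matrix.smul_one_eq_diagonal, Matrix.exp_diagonal, Matrix.smul_one_eq_diagonal,
      Complex.exp_eq_exp_ℂ]
    congr 1
    ext i
    simp [Pi.coe_exp]
  have e3 : NormedSpace.exp ((-(s : ℂ)) • (A - μ • 1)) *ᵥ v = ∑ n ∈ Finset.range k,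
      ((n.factorial : ℂ)⁻¹ • ((-(s : ℂ)) • (A - μ • 1)) ^ n) *ᵥ v := by
    rw [NormedSpace.exp_eq_tsum ℂ]
    have hs := (summ_exp ((-(s : ℂ)) • (A - μ • 1))).hasSum
    have hc : Continuous fun M : Matrix (Fin p) (Fin p) ℂ => M *ᵥ v := by fun_prop
    have h2 := hs.map (⟨⟨fun M : Matrix (Fin p) (Fin p) ℂ => M *ᵥ v, by simp⟩,
      fun M M' => Matrix.add_mulVec M M' v⟩ : Matrix (Fin p) (Fin p) ℂ →+ (Fin p → ℂ)) hc
    refine h2.unique (hasSum_sum_of_ne_finset_zero fun n hn => ?_)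
    simp only [Finset.mem_range, not_lt] at hn
    obtain ⟨m, rfl⟩ := Nat.exists_eq_add_of_le hn
    simp only [Function.comp, AddMonoidHom.coe_mk, ZeroHom.coe_mk]
    rw [smul_pow, add_comm k m, pow_add (A - μ • 1), Matrix.smul_mulVec, Matrix.smul_mulVec, ← Matrix.mulVec_mulVec, hv]
    simp
  rw [e1, Matrix.exp_add_of_commute _ _ (((Commute.one_left _).smul_left _).smul_right _ |> fun h => h),
    e2, ← Matrix.mulVec_mulVec, e3, Matrix.smul_mulVec, Matrix.one_mulVec, Finset.smul_sum]
  refine Finset.sum_congr rfl fun n _ => ?_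
  rw [smul_pow, Matrix.smul_mulVec, Matrix.smul_mulVec, smul_smul, smul_smul, smul_smul]
  congr 1
  rw [neg_pow]; ring

lemma dec_vec {p : ℕ} (A : Matrix (Fin p) (Fin p) ℂ) (hA : ∀ μ ∈ spectrum ℂ A, 0 < μ.re)
    (v : Fin p → ℂ) (i : Fin p) :
    Dec fun s : ℝ => (NormedSpace.exp (-((s : ℂ) • A)) *ᵥ v) i := by
  have hv : v ∈ ⨆ μ : ℂ, Module.End.maxGenEigenspace (Matrix.toLin' A) μ := by
    rw [Module.End.iSup_maxGenEigenspace_eq_top]; trivial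
  induction hv using Submodule.iSup_induction' with
  | zero => simpa using Dec.zero
  | add x y _ _ hx hy => simpa [Matrix.mulVec_add] using hx.add hy
  | mem μ v hv =>
    by_cases hμ : Module.End.HasEigenvalue (Matrix.toLin' A) μ
    · have hre : 0 < μ.re := hA μ (by
        rw [← Matrix.spectrum_toLin']; exact hμ.mem_spectrum)
      rw [Module.End.mem_maxGenEigenspace] at hv
      obtain ⟨k, hk⟩ := hv
      have hk' : (A - μ • 1) ^ k *ᵥ v = 0 := by
        rw [← hk, ← Matrix.toLin'_apply, Matrix.toLin'_pow, map_sub, map_smul, Matrix.toLin'_one]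
        rfl
      have := fun s : ℝ => exp_genEig A μ v k hk' s
      simp only [this, Finset.sum_apply, Pi.smul_apply, smul_eq_mul]
      refine Dec.sum _ fun n _ => ?_
      have h := (dec_basic μ hre n).const_mul ((n.factorial : ℂ)⁻¹ * (-1) ^ n * ((A - μ • 1) ^ n *ᵥ v) i)
      convert h using 2
      ring
    · have : v = 0 := by
        by_contra hne
        apply hμ
        rw [Module.End.mem_maxGenEigenspace] at hv
        obtain ⟨k, hk⟩ := hv
        refine Module.End.hasEigenvalue_of_hasGenEigenvalue (k := k) ?_
        intro hbot
        apply hne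
        have : v ∈ Module.End.genEigenspace (Matrix.toLin' A) μ k := by
          rw [Module.End.mem_genEigenspace_nat]; exact hk
        rw [hbot] at this
        simpa using this
      subst this
      simpa using Dec.zero

def DecM {p : ℕ} (A : Matrix (Fin p) (Fin p) ℝ) : Prop :=
  ∀ i j, Dec fun s => ((mexp (-(s • A)) i j : ℝ) : ℂ)

lemma decM_of {p : ℕ} {A : Matrix (Fin p) (Fin p) ℝ} (hA : EigPos A) : DecM A := by
  intro i j
  have := dec_vec (A.map Complex.ofReal) hA (Pi.single j 1) i
  convert this using 2 with s
  rw [Matrix.mulVec_single_one, mexp_eq]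
  have h : -((s : ℂ) • A.map Complex.ofReal) = (-(s • A)).map Complex.ofReal := by
    ext a b; simp
  rw [h, ← map_mexp]
  rfl

lemma mexp_transpose {p : ℕ} (A : Matrix (Fin p) (Fin p) ℝ) : mexp Aᵀ = (mexp A)ᵀ := by
  rw [mexp_eq, mexp_eq, Matrix.exp_transpose]

lemma mexp_nsT {p : ℕ} (A : Matrix (Fin p) (Fin p) ℝ) (s : ℝ) :
    mexp (-(s • Aᵀ)) = (mexp (-(s • A)))ᵀ := by
  rw [← mexp_transpose]; simp

lemma DecM.transpose {p : ℕ} {A : Matrix (Fin p) (Fin p) ℝ} (h : DecM A) : DecM Aᵀ := by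
  intro i j
  simp only [mexp_nsT]
  exact h j i

lemma cont_e {p : ℕ} (A : Matrix (Fin p) (Fin p) ℝ) : Continuous fun s : ℝ => mexp (-(s • A)) := by
  simp only [mexp_eq]
  exact cont_mexp.comp (by fun_prop)

lemma integrand_int {p : ℕ} {A : Matrix (Fin p) (Fin p) ℝ} (h : DecM A)
    (C : Matrix (Fin 1) (Fin p) ℝ) (i j : Fin p) :
    IntegrableOn (fun s : ℝ => (mexp (-(s • Aᵀ)) * (Cᵀ * C) * mexp (-(s • A))) i j) (Set.Ioi 0) := by
  have hd : Dec fun s : ℝ => (((mexp (-(s • Aᵀ)) * (Cᵀ * C) * mexp (-(s • A))) i j : ℝ) : ℂ) := by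
    simp only [Matrix.mul_apply (M := _ * _) (N := mexp _), Matrix.mul_apply (N := Cᵀ * C),
      Complex.ofReal_sum, Complex.ofReal_mul]
    refine Dec.sum _ fun a _ => Dec.mul (Dec.sum _ fun b _ => ?_) (h a j)
    have := (h.transpose i b).const_mul (((Cᵀ * C) b a : ℝ) : ℂ)
    convert this using 2
    ring
  obtain ⟨b, hb, hO⟩ := hd
  refine integrable_of_isBigO_exp_neg hb (Continuous.continuousOn ?_) ?_
  · have := cont_e A
    have := cont_e Aᵀ
    refine Continuous.matrix_elem (by fun_prop) i j
  · refine Asymptotics.IsBigO.trans (Asymptotics.IsBigO.of_bound 1 ?_) hO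
    exact Eventually.of_forall fun s => by simp

lemma Q_psd {p : ℕ} {A : Matrix (Fin p) (Fin p) ℝ} (h : DecM A)
    (C : Matrix (Fin 1) (Fin p) ℝ) : (Qmat A C).PosSemidef := by
  have hG : ∀ s : ℝ, (mexp (-(s • Aᵀ)) * (Cᵀ * C) * mexp (-(s • A))).PosSemidef := by
    intro s
    have := Matrix.posSemidef_conjTranspose_mul_self (C * mexp (-(s • A)))
    rw [mexp_nsT]
    simpa [Matrix.conjTranspose_eq_transpose_of_trivial, Matrix.mul_assoc] using this
  refine Matrix.PosSemidef.of_dotProduct_mulVec_nonneg ?_ fun v => ?_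
  · ext i j
    simp only [Qmat, Matrix.conjTranspose_apply, Matrix.of_apply, star_trivial]
    congr 1
    ext s
    exact (hG s).1.apply i j
  · have : star v ⬝ᵥ (Qmat A C *ᵥ v) = ∫ s in Set.Ioi (0 : ℝ),
        star v ⬝ᵥ ((mexp (-(s • Aᵀ)) * (Cᵀ * C) * mexp (-(s • A))) *ᵥ v) := by
      simp only [dotProduct, Matrix.mulVec]
      rw [integral_finset_sum]
      · refine Finset.sum_congr rfl fun i _ => ?_
        rw [integral_const_mul, integral_finset_sum]
        · congr 1
          refine Finset.sum_congr rfl fun j _ => ?_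
          rw [integral_mul_const]
          rfl
        · exact fun j _ => (integrand_int h C i j).mul_const _
      · exact fun i _ => (integrable_finset_sum _ fun j _ =>
          (integrand_int h C i j).mul_const _).const_mul _
    rw [this]
    exact integral_nonneg fun s => (hG s).dotProduct_mulVec_nonneg v

lemma N_eq {p : ℕ} (A : Matrix (Fin p) (Fin p) ℝ) (B : Matrix (Fin p) (Fin 1) ℝ) :
    Nmat A B = Qmat Aᵀ Bᵀ := by
  simp [Nmat, Qmat]

lemma isUnit_one_add {p : ℕ} {Q N : Matrix (Fin p) (Fin p) ℝ} (hQ : Q.PosSemidef)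
    (hN : N.PosSemidef) : IsUnit (1 + Q * N) := by
  open scoped MatrixOrder in
  obtain ⟨R, hR⟩ := (CStarAlgebra.nonneg_iff_eq_star_mul_self (a := Q)).mp hQ.nonneg
  rw [Matrix.isUnit_iff_isUnit_det, hR, mul_assoc, Matrix.det_one_add_mul_comm,
    ← Matrix.isUnit_iff_isUnit_det]
  have h := hN.mul_mul_conjTranspose_same R
  exact (Matrix.PosDef.one.add_posSemidef h).isUnit

end helpers

theorem statement2 {p : ℕ} (hp : 0 < p) (A : Matrix (Fin p) (Fin p) ℝ)
    (B : Matrix (Fin p) (Fin 1) ℝ) (C : Matrix (Fin 1) (Fin p) ℝ)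
    (hA : EigPos A) (hobs : Observable A C) (hctrl : Controllable A B) :
    ∀ x t : ℝ, IsUnit (Fmat A B C x t) := by
  intro x t
  have hQ := Q_psd (decM_of hA) C
  have hN : (Nmat A B).PosSemidef := N_eq A B ▸ Q_psd (decM_of hA).transpose Bᵀ
  set M : Matrix (Fin p) (Fin p) ℝ := -(x • A) + (4 * t) • A ^ 3 with hM
  set E := mexp M with hE
  have h1 : mexp (-((2 * x) • A) + (8 * t) • A ^ 3) = E * E := by
    rw [hE, mexp_eq, mexp_eq, ← Matrix.exp_add_of_commute _ _ (Commute.refl _), hM]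
    congr 1
    module
  have hu : IsUnit E := by rw [hE, mexp_eq]; exact Matrix.isUnit_exp _
  have hu' : IsUnit Eᵀ := by rwa [Matrix.isUnit_transpose]
  have h2 : Eᵀ * mexp ((2 * x) • Aᵀ - (8 * t) • Aᵀ ^ 3) * Eᵀ = 1 := by
    have hc : ∀ a b c d : ℝ, Commute (a • Aᵀ + b • Aᵀ ^ 3) (c • Aᵀ + d • Aᵀ ^ 3) := by
      intro a b c d
      have h13 : Commute Aᵀ (Aᵀ ^ 3) := (Commute.refl _).pow_right 3
      exact ((((Commute.refl _).smul_left _).smul_right _).add_right ((h13.smul_left _).smul_right _)).add_left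
        (((h13.symm.smul_left _).smul_right _).add_right (((Commute.refl _).smul_left _).smul_right _))
    have e1 : Mᵀ = (-x) • Aᵀ + (4 * t) • Aᵀ ^ 3 := by
      rw [hM]; simp [Matrix.transpose_pow]
    have e2 : (2 * x) • Aᵀ - (8 * t) • Aᵀ ^ 3 = (2 * x) • Aᵀ + (-(8 * t)) • Aᵀ ^ 3 := by module
    rw [hE, ← mexp_transpose, mexp_eq, mexp_eq, e1, e2, ← Matrix.exp_add_of_commute _ _ (hc _ _ _ _)]
    have e3 : (-x) • Aᵀ + (4 * t) • Aᵀ ^ 3 + ((2 * x) • Aᵀ + (-(8 * t)) • Aᵀ ^ 3)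
      = x • Aᵀ + (-(4 * t)) • Aᵀ ^ 3 := by module
    rw [e3, ← Matrix.exp_add_of_commute _ _ (hc _ _ _ _)]
    have e4 : x • Aᵀ + (-(4 * t)) • Aᵀ ^ 3 + ((-x) • Aᵀ + (4 * t) • Aᵀ ^ 3) = 0 := by module
    rw [e4, NormedSpace.exp_zero]
  have h3 : Eᵀ * Fmat A B C x t * Eᵀ = 1 + (Eᵀ * Qmat A C * E) * (E * Nmat A B * Eᵀ) := by
    rw [Fmat, h1, mul_add, add_mul, h2]
    simp only [mul_assoc]
  have h4 : IsUnit (Eᵀ * Fmat A B C x t * Eᵀ) := by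
    rw [h3]
    apply isUnit_one_add
    · simpa [Matrix.conjTranspose_eq_transpose_of_trivial] using hQ.conjTranspose_mul_mul_same E
    · simpa [Matrix.conjTranspose_eq_transpose_of_trivial] using hN.mul_mul_conjTranspose_same E
  obtain ⟨u, hu⟩ := hu'
  rw [← hu] at h4
  rwa [Units.isUnit_mul_units, Units.isUnit_units_mul] at h4
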